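/- Let G be a Garside group with Garside element Δ and N = ‖Δ‖. For every element g of G, the following are equivalent: (i) g is inf-straight, i.e. inf(g) = t_inf(g); (ii) inf(g^N) = N·inf(g); (iii) inf(g^k) = k·inf(g) for every integer k ≥ 1. -/

import Mathlib

open Filter Topology Pointwise

/-- Left divisibility order on a group relative to a submonoid `P` of positive elements:
`a ≤_L b` iff `a⁻¹ * b ∈ P`. -/
def leL {G : Type*} [Group G] (P : Submonoid G) (a b : G) : Prop := a⁻¹ * b ∈ P

/-- Right divisibility order: `a ≤_R b` iff `b * a⁻¹ ∈ P`. -/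
def leR {G : Type*} [Group G] (P : Submonoid G) (a b : G) : Prop := b * a⁻¹ ∈ P

/-- An atom of the positive monoid `P`: a nontrivial element admitting no nontrivial
factorization inside `P`. -/
def IsMonAtom {G : Type*} [Group G] (P : Submonoid G) (a : G) : Prop :=
  a ∈ P ∧ a ≠ 1 ∧ ∀ b c : G, b ∈ P → c ∈ P → a = b * c → b = 1 ∨ c = 1

/-- `a` can be written as a product of `n` atoms of `P`. -/
def IsAtomProd {G : Type*} [Group G] (P : Submonoid G) (n : ℕ) (a : G) : Prop :=
  ∃ l : List G, l.length = n ∧ (∀ x ∈ l, IsMonAtom P x) ∧ l.prod = a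

/-- A Garside structure on a group `G`: `G` is the group of fractions of the positive
monoid `P`, which is a finitely generated atomic monoid (with atomic norm `norm`),
a lattice for both `≤_L` and `≤_R`, equipped with a Garside element `Δ` whose left and
right divisors coincide and generate `P`.  The fields `zinf`, `zsup`, `infs`, `sups`,
`tinf`, `tsup` are the (uniquely determined) invariants
`inf g = max {r : Δ^r ≤_L g}`, `sup g = min {s : g ≤_L Δ^s}`,
`inf_s g = max {inf h : h ∈ [g]}`, `sup_s g = min {sup h : h ∈ [g]}`,
`t_inf g = lim inf(gⁿ)/n` and `t_sup g = lim sup(gⁿ)/n`,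
each given together with its defining specification. -/
structure GarsideGroup (G : Type*) [Group G] where
  P : Submonoid G
  /-- `G` is the group of fractions of `P`. -/
  fraction : ∀ g : G, ∃ a b : G, a ∈ P ∧ b ∈ P ∧ g = a⁻¹ * b
  /-- `P` is finitely generated. -/
  fg : P.FG
  /-- the atomic norm `‖·‖` -/
  norm : G → ℕ
  /-- `P` is atomic: every positive element is a product of atoms and `norm a` is the
  greatest length of such an expression. -/
  norm_spec : ∀ a ∈ P, IsGreatest {n : ℕ | IsAtomProd P n a} (norm a)
  /-- `(P, ≤_L)` is a lattice: gcd's and lcm's exist. -/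
  latticeL : ∀ a ∈ P, ∀ b ∈ P,
    (∃ c ∈ P, leL P c a ∧ leL P c b ∧ ∀ d ∈ P, leL P d a → leL P d b → leL P d c) ∧
    (∃ c ∈ P, leL P a c ∧ leL P b c ∧ ∀ d ∈ P, leL P a d → leL P b d → leL P c d)
  /-- `(P, ≤_R)` is a lattice. -/
  latticeR : ∀ a ∈ P, ∀ b ∈ P,
    (∃ c ∈ P, leR P c a ∧ leR P c b ∧ ∀ d ∈ P, leR P d a → leR P d b → leR P d c) ∧
    (∃ c ∈ P, leR P a c ∧ leR P b c ∧ ∀ d ∈ P, leR P a d → leR P b d → leR P c d)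
  /-- the Garside element -/
  Δ : G
  Δ_mem : Δ ∈ P
  /-- the left and right divisors of `Δ` coincide -/
  Δ_balanced : ∀ a ∈ P, (leL P a Δ ↔ leR P a Δ)
  /-- the simple elements generate `P` -/
  simples_gen : Submonoid.closure {a : G | a ∈ P ∧ leL P a Δ} = P
  /-- `inf g = max {r : ℤ | Δ^r ≤_L g}` -/
  zinf : G → ℤ
  /-- `sup g = min {s : ℤ | g ≤_L Δ^s}` -/
  zsup : G → ℤ
  zinf_spec : ∀ g : G, IsGreatest {r : ℤ | leL P (Δ ^ r) g} (zinf g)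
  zsup_spec : ∀ g : G, IsLeast {s : ℤ | leL P g (Δ ^ s)} (zsup g)
  /-- `inf_s g = max {inf h : h ∈ [g]}` -/
  infs : G → ℤ
  /-- `sup_s g = min {sup h : h ∈ [g]}` -/
  sups : G → ℤ
  infs_spec : ∀ g : G, IsGreatest (Set.range fun h : G => zinf (h⁻¹ * g * h)) (infs g)
  sups_spec : ∀ g : G, IsLeast (Set.range fun h : G => zsup (h⁻¹ * g * h)) (sups g)
  /-- `t_inf g = lim_{n → ∞} inf(gⁿ)/n` -/
  tinf : G → ℝ
  /-- `t_sup g = lim_{n → ∞} sup(gⁿ)/n` -/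
  tsup : G → ℝ
  tinf_spec : ∀ g : G,
    Filter.Tendsto (fun n : ℕ => (zinf (g ^ n) : ℝ) / (n : ℝ)) Filter.atTop (nhds (tinf g))
  tsup_spec : ∀ g : G,
    Filter.Tendsto (fun n : ℕ => (zsup (g ^ n) : ℝ) / (n : ℝ)) Filter.atTop (nhds (tsup g))

namespace GarsideGroup

variable {G : Type*} [Group G] (Γ : GarsideGroup G)

/-- The set `𝒟` of simple elements. -/
def simples : Set G := {a : G | a ∈ Γ.P ∧ leL Γ.P a Γ.Δ}

/-- `len g = sup g - inf g` -/
def len (g : G) : ℤ := Γ.zsup g - Γ.zinf g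

/-- `t_len g = t_sup g - t_inf g` -/
noncomputable def tlen (g : G) : ℝ := Γ.tsup g - Γ.tinf g

/-- `g` is inf-straight if `inf g = t_inf g`. -/
def InfStraight (g : G) : Prop := (Γ.zinf g : ℝ) = Γ.tinf g

/-- `g` is sup-straight if `sup g = t_sup g`. -/
def SupStraight (g : G) : Prop := (Γ.zsup g : ℝ) = Γ.tsup g

/-- The super summit set `[g]^S`. -/
def superSummit (g : G) : Set G :=
  {h : G | (∃ x : G, x⁻¹ * g * x = h) ∧ Γ.zinf h = Γ.infs g ∧ Γ.zsup h = Γ.sups g}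

end GarsideGroup

/-- The shortest length of a word over the alphabet `X` representing `g`. -/
noncomputable def wlen {G : Type*} [Group G] (X : Set G) (g : G) : ℕ :=
  sInf {n : ℕ | ∃ l : List G, l.length = n ∧ (∀ x ∈ l, x ∈ X) ∧ l.prod = g}

namespace GarsideGroup

variable {G : Type*} [Group G] (Γ : GarsideGroup G)

lemma conj_mem_inv {a : G} (ha : a ∈ Γ.P) : Γ.Δ⁻¹ * a * Γ.Δ ∈ Γ.P := by
  have ha' : a ∈ Submonoid.closure {a : G | a ∈ Γ.P ∧ leL Γ.P a Γ.Δ} := by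
    rw [Γ.simples_gen]; exact ha
  induction ha' using Submonoid.closure_induction with
  | mem s hs =>
    obtain ⟨h1, h2⟩ := hs
    have h3 : s⁻¹ * Γ.Δ ∈ Γ.P := h2
    have h4 : leR Γ.P (s⁻¹ * Γ.Δ) Γ.Δ := by
      unfold leR
      have : Γ.Δ * (s⁻¹ * Γ.Δ)⁻¹ = s := by group
      rw [this]; exact h1
    have h5 := (Γ.Δ_balanced _ h3).2 h4
    unfold leL at h5
    have : Γ.Δ⁻¹ * s * Γ.Δ = (s⁻¹ * Γ.Δ)⁻¹ * Γ.Δ := by group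
    rw [this]; exact h5
  | one => simpa using Γ.P.one_mem
  | mul x y hx hy ihx ihy =>
    rw [Γ.simples_gen] at hx hy
    have : Γ.Δ⁻¹ * (x * y) * Γ.Δ = (Γ.Δ⁻¹ * x * Γ.Δ) * (Γ.Δ⁻¹ * y * Γ.Δ) := by group
    rw [this]; exact Γ.P.mul_mem (ihx hx) (ihy hy)

lemma conj_mem {a : G} (ha : a ∈ Γ.P) : Γ.Δ * a * Γ.Δ⁻¹ ∈ Γ.P := by
  have ha' : a ∈ Submonoid.closure {a : G | a ∈ Γ.P ∧ leL Γ.P a Γ.Δ} := by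
    rw [Γ.simples_gen]; exact ha
  induction ha' using Submonoid.closure_induction with
  | mem s hs =>
    obtain ⟨h1, h2⟩ := hs
    have h3 : Γ.Δ * s⁻¹ ∈ Γ.P := (Γ.Δ_balanced _ h1).1 h2
    have h4 : leL Γ.P (Γ.Δ * s⁻¹) Γ.Δ := by
      unfold leL
      have : (Γ.Δ * s⁻¹)⁻¹ * Γ.Δ = s := by group
      rw [this]; exact h1
    have h5 := (Γ.Δ_balanced _ h3).1 h4
    unfold leR at h5
    have : Γ.Δ * s * Γ.Δ⁻¹ = Γ.Δ * (Γ.Δ * s⁻¹)⁻¹ := by group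
    rw [this]; exact h5
  | one => simpa using Γ.P.one_mem
  | mul x y hx hy ihx ihy =>
    rw [Γ.simples_gen] at hx hy
    have : Γ.Δ * (x * y) * Γ.Δ⁻¹ = (Γ.Δ * x * Γ.Δ⁻¹) * (Γ.Δ * y * Γ.Δ⁻¹) := by group
    rw [this]; exact Γ.P.mul_mem (ihx hx) (ihy hy)

lemma conj_zpow_mem (r : ℤ) {a : G} (ha : a ∈ Γ.P) : Γ.Δ ^ r * a * Γ.Δ ^ (-r) ∈ Γ.P := by
  induction r with
  | zero => simpa using ha
  | succ n ih =>
    have : Γ.Δ ^ ((n : ℤ) + 1) * a * Γ.Δ ^ (-((n : ℤ) + 1))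
        = Γ.Δ * (Γ.Δ ^ (n : ℤ) * a * Γ.Δ ^ (-(n : ℤ))) * Γ.Δ⁻¹ := by group
    rw [this]; exact Γ.conj_mem ih
  | pred n ih =>
    have : Γ.Δ ^ (-(n : ℤ) - 1) * a * Γ.Δ ^ (-(-(n : ℤ) - 1))
        = Γ.Δ⁻¹ * (Γ.Δ ^ (-(n : ℤ)) * a * Γ.Δ ^ (-(-(n : ℤ)))) * Γ.Δ := by group
    rw [this]; exact Γ.conj_mem_inv ih

lemma zinf_mem (g : G) : Γ.Δ ^ (-Γ.zinf g) * g ∈ Γ.P := by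
  have := (Γ.zinf_spec g).1
  simp only [Set.mem_setOf_eq, leL] at this
  rwa [zpow_neg]

lemma le_zinf {r : ℤ} {g : G} (h : Γ.Δ ^ (-r) * g ∈ Γ.P) : r ≤ Γ.zinf g := by
  apply (Γ.zinf_spec g).2
  simp only [Set.mem_setOf_eq, leL]
  rwa [← zpow_neg]

lemma mem_of_le_zinf {r : ℤ} {g : G} (h : r ≤ Γ.zinf g) : Γ.Δ ^ (-r) * g ∈ Γ.P := by
  obtain ⟨n, hn⟩ := Int.le.dest h
  have : Γ.Δ ^ (-r) * g = Γ.Δ ^ n * (Γ.Δ ^ (-Γ.zinf g) * g) := by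
    rw [← hn, ← mul_assoc, ← zpow_natCast, ← zpow_add]; congr 2; ring
  rw [this]
  exact Γ.P.mul_mem (Γ.P.pow_mem Γ.Δ_mem n) (Γ.zinf_mem g)

lemma zinf_mul (g h : G) : Γ.zinf g + Γ.zinf h ≤ Γ.zinf (g * h) := by
  apply Γ.le_zinf
  have h1 := Γ.conj_zpow_mem (-Γ.zinf h) (Γ.zinf_mem g)
  have h2 := Γ.P.mul_mem h1 (Γ.zinf_mem h)
  convert h2 using 1
  group

lemma zinf_pow (g : G) (n : ℕ) : (n : ℤ) * Γ.zinf g ≤ Γ.zinf (g ^ n) := by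
  induction n with
  | zero => exact Γ.le_zinf (by simp [Γ.P.one_mem])
  | succ n ih =>
    have := Γ.zinf_mul (g ^ n) g
    rw [pow_succ]; push_cast; linarith

lemma pow_of_straight {g : G} (h : Γ.InfStraight g) (k : ℕ) (hk : 1 ≤ k) :
    Γ.zinf (g ^ k) = (k : ℤ) * Γ.zinf g := by
  apply le_antisymm _ (Γ.zinf_pow g k)
  have hk0 : (0 : ℝ) < k := by exact_mod_cast hk
  have ht : Tendsto (fun n : ℕ => k * n) atTop atTop :=
    tendsto_id.const_mul_atTop' (by omega)
  have h1 := (Γ.tinf_spec g).comp ht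
  have h2 : (Γ.zinf (g ^ k) : ℝ) / k ≤ Γ.tinf g := by
    refine ge_of_tendsto h1 ?_
    filter_upwards [eventually_ge_atTop 1] with n hn
    have hn0 : (0 : ℝ) < n := by exact_mod_cast hn
    have h3 := Γ.zinf_pow (g ^ k) n
    rw [← pow_mul] at h3
    have h3' : (n : ℝ) * (Γ.zinf (g ^ k) : ℝ) ≤ (Γ.zinf (g ^ (k * n)) : ℝ) := by exact_mod_cast h3
    simp only [Function.comp, Nat.cast_mul]
    rw [div_le_div_iff₀ hk0 (by positivity)]
    nlinarith
  unfold InfStraight at h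
  rw [← h, div_le_iff₀ hk0] at h2
  have : (Γ.zinf (g ^ k) : ℝ) ≤ k * Γ.zinf g := by linarith
  exact_mod_cast this

lemma straight_of_pow {g : G} (h : ∀ k : ℕ, 1 ≤ k → Γ.zinf (g ^ k) = (k : ℤ) * Γ.zinf g) :
    Γ.InfStraight g := by
  refine tendsto_nhds_unique ?_ (Γ.tinf_spec g)
  refine tendsto_const_nhds.congr' ?_
  filter_upwards [eventually_ge_atTop 1] with n hn
  have hn0 : (0 : ℝ) < n := by exact_mod_cast hn
  rw [h n hn]; push_cast; field_simp

lemma norm_mul {a b : G} (ha : a ∈ Γ.P) (hb : b ∈ Γ.P) :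
    Γ.norm a + Γ.norm b ≤ Γ.norm (a * b) := by
  obtain ⟨l, h1, h2, h3⟩ := (Γ.norm_spec a ha).1
  obtain ⟨m, h4, h5, h6⟩ := (Γ.norm_spec b hb).1
  apply (Γ.norm_spec _ (Γ.P.mul_mem ha hb)).2
  refine ⟨l ++ m, by simp [h1, h4], ?_, by simp [h3, h6]⟩
  intro x hx
  rcases List.mem_append.1 hx with hx | hx
  exacts [h2 x hx, h5 x hx]

lemma norm_pos {a : G} (ha : a ∈ Γ.P) (h : a ≠ 1) : 1 ≤ Γ.norm a := by
  by_contra hc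
  obtain ⟨l, h1, h2, h3⟩ := (Γ.norm_spec a ha).1
  have : l = [] := List.length_eq_zero_iff.1 (by omega)
  subst this
  exact h (by simpa using h3.symm)

lemma norm_lt {a b : G} (ha : a ∈ Γ.P) (hab : leR Γ.P a b) (h : a ≠ b) :
    Γ.norm a < Γ.norm b := by
  have h1 := Γ.norm_mul hab ha
  have h2 := Γ.norm_pos hab (fun e => h (mul_inv_eq_one.1 e).symm)
  rw [inv_mul_cancel_right] at h1
  omega

lemma norm_Δ_pos : 1 ≤ Γ.norm Γ.Δ := by
  apply Γ.norm_pos Γ.Δ_mem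
  intro h
  have := Γ.le_zinf (r := Γ.zinf 1 + 1) (g := 1) (by rw [h]; simp [Γ.P.one_mem])
  omega

lemma leR_trans {a b c : G} (h1 : leR Γ.P a b) (h2 : leR Γ.P b c) : leR Γ.P a c := by
  unfold leR at *
  have := Γ.P.mul_mem h2 h1
  convert this using 1; group

/-- A simple right divisor of a product `a * b` right-divides `t * b` for a simple right
divisor `t` of `a`. -/
lemma head_div {s a b : G} (hs : s ∈ Γ.P) (hsΔ : leR Γ.P s Γ.Δ) (ha : a ∈ Γ.P) (hb : b ∈ Γ.P)
    (h : leR Γ.P s (a * b)) :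
    ∃ t ∈ Γ.P, leR Γ.P t Γ.Δ ∧ leR Γ.P t a ∧ leR Γ.P s (t * b) := by
  obtain ⟨c, hc, hsc, hbc, hmin⟩ := (Γ.latticeR s hs b hb).2
  refine ⟨c * b⁻¹, hbc, ?_, ?_, by simpa using hsc⟩
  · have h1 := hmin (Γ.Δ * b) (Γ.P.mul_mem Γ.Δ_mem hb)
      (Γ.leR_trans hsΔ (Γ.conj_mem hb)) (by simpa [leR] using Γ.Δ_mem)
    unfold leR at *
    convert h1 using 1; group
  · have h1 := hmin (a * b) (Γ.P.mul_mem ha hb) h (by simpa [leR] using ha)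
    unfold leR at *
    convert h1 using 1; group

/-- The normalised power `Δ^(-k inf g) g^k`. -/
def qpow (g : G) (k : ℕ) : G := Γ.Δ ^ (-((k : ℤ) * Γ.zinf g)) * g ^ k

lemma qpow_mem (g : G) (k : ℕ) : Γ.qpow g k ∈ Γ.P := Γ.mem_of_le_zinf (Γ.zinf_pow g k)

/-- Simple right divisors of the normalised power. -/
def sdiv (g : G) (k : ℕ) : Set G := {s | s ∈ Γ.P ∧ leR Γ.P s Γ.Δ ∧ leR Γ.P s (Γ.qpow g k)}

lemma sdiv_mono (g : G) (k : ℕ) : Γ.sdiv g k ⊆ Γ.sdiv g (k + 1) := by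
  rintro s ⟨h1, h2, h3⟩
  refine ⟨h1, h2, Γ.leR_trans h3 ?_⟩
  have h := Γ.conj_zpow_mem (-((k : ℤ) * Γ.zinf g)) (Γ.zinf_mem g)
  unfold leR qpow
  convert h using 1
  rw [pow_succ']
  push_cast
  have : (-(((k : ℤ) + 1) * Γ.zinf g)) = -((k : ℤ) * Γ.zinf g) + -Γ.zinf g := by ring
  rw [this, zpow_add]
  group

lemma sdiv_succ (g : G) (k : ℕ) (s : G) : s ∈ Γ.sdiv g (k + 1) ↔
    s ∈ Γ.P ∧ leR Γ.P s Γ.Δ ∧ ∃ t ∈ Γ.sdiv g k, leR Γ.P s (Γ.Δ ^ (-Γ.zinf g) * t * g) := by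
  have hq : Γ.qpow g (k + 1) = Γ.Δ ^ (-Γ.zinf g) * Γ.qpow g k * g := by
    unfold qpow
    rw [pow_succ]
    push_cast
    have : (-(((k : ℤ) + 1) * Γ.zinf g)) = -Γ.zinf g + -((k : ℤ) * Γ.zinf g) := by ring
    rw [this, zpow_add]
    group
  constructor
  · rintro ⟨h1, h2, h3⟩
    refine ⟨h1, h2, ?_⟩
    have e : Γ.qpow g (k + 1) = (Γ.Δ ^ (-Γ.zinf g) * Γ.qpow g k * Γ.Δ ^ (-(-Γ.zinf g)))
        * (Γ.Δ ^ (-Γ.zinf g) * g) := by rw [hq]; group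
    rw [e] at h3
    obtain ⟨t, ht, htΔ, hta, hst⟩ := Γ.head_div h1 h2
      (Γ.conj_zpow_mem (-Γ.zinf g) (Γ.qpow_mem g k)) (Γ.zinf_mem g) h3
    refine ⟨Γ.Δ ^ (Γ.zinf g) * t * Γ.Δ ^ (-Γ.zinf g), ⟨Γ.conj_zpow_mem _ ht, ?_, ?_⟩, ?_⟩
    · have := Γ.conj_zpow_mem (Γ.zinf g) htΔ
      unfold leR
      convert this using 1; group
    · have := Γ.conj_zpow_mem (Γ.zinf g) hta
      unfold leR
      convert this using 1; group
    · convert hst using 1; group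
  · rintro ⟨h1, h2, t, ⟨ht, htΔ, hta⟩, hst⟩
    refine ⟨h1, h2, Γ.leR_trans hst ?_⟩
    rw [hq]
    have := Γ.conj_zpow_mem (-Γ.zinf g) hta
    unfold leR
    convert this using 1; group

lemma sdiv_stable (g : G) {k : ℕ} (h : Γ.sdiv g k = Γ.sdiv g (k + 1)) (n : ℕ) :
    Γ.sdiv g (k + n) = Γ.sdiv g k := by
  have step : ∀ n, Γ.sdiv g (k + n) = Γ.sdiv g (k + n + 1) := by
    intro n
    induction n with
    | zero => exact h
    | succ n ih =>
      ext s
      rw [← add_assoc, Γ.sdiv_succ g (k + n), Γ.sdiv_succ g (k + n + 1), ih]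
  induction n with
  | zero => rfl
  | succ n ih => rw [← add_assoc, ← step n, ih]

lemma sdiv_gcd (g : G) (k : ℕ) : ∃ e ∈ Γ.sdiv g k, ∀ d ∈ Γ.sdiv g k, leR Γ.P d e := by
  obtain ⟨c, hc, h1, h2, h3⟩ := (Γ.latticeR Γ.Δ Γ.Δ_mem _ (Γ.qpow_mem g k)).1
  exact ⟨c, ⟨hc, h1, h2⟩, fun d hd => h3 d hd.1 hd.2.1 hd.2.2⟩

lemma Δ_mem_sdiv_N (g : G) {m : ℕ} (hm : Γ.Δ ∈ Γ.sdiv g m) :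
    Γ.Δ ∈ Γ.sdiv g (Γ.norm Γ.Δ) := by
  have mono : Monotone (Γ.sdiv g) := monotone_nat_of_le_succ (Γ.sdiv_mono g)
  by_cases hst : ∃ k < Γ.norm Γ.Δ, Γ.sdiv g k = Γ.sdiv g (k + 1)
  · obtain ⟨k, hk, he⟩ := hst
    have h1 := Γ.sdiv_stable g he m
    have h2 := mono (show m ≤ k + m by omega) hm
    rw [h1] at h2
    exact mono hk.le h2
  · push Not at hst
    choose e he hmax using Γ.sdiv_gcd g
    have key : ∀ k ≤ Γ.norm Γ.Δ, k ≤ Γ.norm (e k) := by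
      intro k
      induction k with
      | zero => intro _; omega
      | succ k ih =>
        intro hk
        have h1 := ih (by omega)
        have h2 : e k ≠ e (k + 1) := by
          intro heq
          apply hst k (by omega)
          apply (Γ.sdiv_mono g k).antisymm
          rintro d hd
          refine ⟨hd.1, hd.2.1, ?_⟩
          have h3 := hmax (k + 1) d hd
          rw [← heq] at h3
          exact Γ.leR_trans h3 (he k).2.2
        have h4 := Γ.norm_lt (he k).1 (hmax (k + 1) _ (Γ.sdiv_mono g k (he k))) h2
        omega
    have h5 := key _ le_rfl
    have h6 : e (Γ.norm Γ.Δ) = Γ.Δ := by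
      by_contra hne
      have := Γ.norm_lt (he (Γ.norm Γ.Δ)).1 (he _).2.1 hne
      omega
    have h7 := he (Γ.norm Γ.Δ)
    rw [h6] at h7
    exact h7

lemma Δ_mem_sdiv_iff (g : G) (k : ℕ) :
    Γ.Δ ∈ Γ.sdiv g k ↔ Γ.zinf (g ^ k) ≠ (k : ℤ) * Γ.zinf g := by
  have hle := Γ.zinf_pow g k
  constructor
  · rintro ⟨-, -, h⟩ heq
    have h1 := Γ.conj_mem_inv h
    have := Γ.le_zinf (r := (k : ℤ) * Γ.zinf g + 1) (g := g ^ k) (by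
      convert h1 using 1
      unfold qpow
      rw [show -((k : ℤ) * Γ.zinf g + 1) = -1 + -((k : ℤ) * Γ.zinf g) by ring, zpow_add]
      group)
    omega
  · intro hne
    refine ⟨Γ.Δ_mem, by simp [leR, Γ.P.one_mem], ?_⟩
    have h1 := Γ.mem_of_le_zinf (r := (k : ℤ) * Γ.zinf g + 1) (g := g ^ k) (by omega)
    have h2 := Γ.conj_mem h1
    unfold leR
    convert h2 using 1
    unfold qpow
    rw [show -((k : ℤ) * Γ.zinf g + 1) = -1 + -((k : ℤ) * Γ.zinf g) by ring, zpow_add]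
    group

end GarsideGroup

/-- `g` is inf-straight ⟺ `inf(g^N) = N·inf(g)` ⟺
`inf(g^k) = k·inf(g)` for all `k ≥ 1`. -/
theorem statement6 {G : Type*} [Group G] (Γ : GarsideGroup G) (g : G) :
    (Γ.InfStraight g ↔ Γ.zinf (g ^ Γ.norm Γ.Δ) = (Γ.norm Γ.Δ : ℤ) * Γ.zinf g) ∧
    (Γ.InfStraight g ↔ ∀ k : ℕ, 1 ≤ k → Γ.zinf (g ^ k) = (k : ℤ) * Γ.zinf g) := by
  refine ⟨⟨fun h => Γ.pow_of_straight h _ Γ.norm_Δ_pos, fun h => Γ.straight_of_pow ?_⟩,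
    ⟨fun h => Γ.pow_of_straight h, fun h => Γ.straight_of_pow h⟩⟩
  intro k _
  by_contra hne
  exact (Γ.Δ_mem_sdiv_iff g _).1 (Γ.Δ_mem_sdiv_N g ((Γ.Δ_mem_sdiv_iff g k).2 hne)) h
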